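/- Let X be a metric space equipped with its Borel σ-algebra, let Γ be a countable group acting on X by measurable isometries, let ν be a Γ-invariant measure on X, and let F ⊆ X be a fundamental domain for the action of Γ with respect to ν (the translates γ·F are pairwise ν-essentially disjoint and cover X up to a ν-null set). Fix a basepoint O ∈ X and a real number s ≥ 0. Assume that (i) Σ_{γ∈Γ} exp(−2s·d(O, γ·O)) < ∞, and (ii) ∫_F exp(2s·d(z, O)) dν(z) < ∞. Then for every x ∈ X the function y ↦ exp(−s·d(x, y)) belongs to L²(X, ν); that is, ∫_X exp(−2s·d(x, y)) dν(y) < ∞. -/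

import Mathlib

open MeasureTheory ENNReal

/-- If `Γ` acts on `X` by measurable isometries preserving the measure `ν`, `F` is a
fundamental domain, the Poincaré series `∑_γ exp (-2s d(O, γO))` converges and
`∫_F exp (2s d(z,O)) dν < ∞`, then for every `x` the function `y ↦ exp (-s d(x,y))`
is square-integrable: `∫ exp (-2s d(x,y)) dν(y) < ∞`. -/
theorem expDist_memL2_of_fundamentalDomain
    {X : Type*} [MetricSpace X] [MeasurableSpace X] [BorelSpace X]
    {Γ : Type*} [Group Γ] [Countable Γ] [MulAction Γ X]
    (hiso : ∀ γ : Γ, Isometry (fun z : X => γ • z))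
    (ν : Measure X) (hinv : ∀ γ : Γ, Measure.map (fun z : X => γ • z) ν = ν)
    (F : Set X) (hF : IsFundamentalDomain Γ F ν)
    (O : X) (s : ℝ) (hs : 0 ≤ s)
    (hsum : Summable fun γ : Γ => Real.exp (-(2 * s) * dist O (γ • O)))
    (hdecay : ∫⁻ z in F, ENNReal.ofReal (Real.exp (2 * s * dist z O)) ∂ν < ⊤) :
    ∀ x : X, ∫⁻ y, ENNReal.ofReal (Real.exp (-(2 * s) * dist x y)) ∂ν < ⊤ := by
  have : MeasurableConstSMul Γ X := ⟨fun γ => (hiso γ).continuous.measurable⟩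
  have : SMulInvariantMeasure Γ X ν := ⟨fun γ t ht => by
    rw [← Measure.map_apply (hiso γ).continuous.measurable ht, hinv γ]⟩
  intro x
  have key (γ : Γ) (y : X) : ENNReal.ofReal (Real.exp (-(2 * s) * dist x (γ • y))) ≤
      ENNReal.ofReal (Real.exp (2 * s * dist O x)) *
        ENNReal.ofReal (Real.exp (-(2 * s) * dist O (γ • O))) *
          ENNReal.ofReal (Real.exp (2 * s * dist y O)) := by
    rw [← ENNReal.ofReal_mul (by positivity), ← ENNReal.ofReal_mul (by positivity),
      ← Real.exp_add, ← Real.exp_add]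
    gcongr
    have h₁ := dist_triangle4 O x (γ • y) (γ • O)
    have h₂ : dist (γ • y) (γ • O) = dist y O := (hiso γ).dist_eq y O
    rw [h₂] at h₁
    linarith [mul_le_mul_of_nonneg_left h₁ (by positivity : 0 ≤ 2 * s)]
  have hsum' : Summable fun γ : Γ => Real.exp (-(2 * s) * dist O (γ⁻¹ • O)) :=
    (Equiv.inv Γ).summable_iff.mpr hsum
  rw [hF.lintegral_eq_tsum']
  calc ∑' γ : Γ, ∫⁻ y in F, ENNReal.ofReal (Real.exp (-(2 * s) * dist x (γ⁻¹ • y))) ∂ν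
      ≤ ∑' γ : Γ, ENNReal.ofReal (Real.exp (2 * s * dist O x)) *
          ENNReal.ofReal (Real.exp (-(2 * s) * dist O (γ⁻¹ • O))) *
            ∫⁻ y in F, ENNReal.ofReal (Real.exp (2 * s * dist y O)) ∂ν := by
        refine ENNReal.tsum_le_tsum fun γ => ?_
        rw [← lintegral_const_mul' _ _ (ENNReal.mul_ne_top ofReal_ne_top ofReal_ne_top)]
        exact lintegral_mono fun y => key γ⁻¹ y
    _ < ⊤ := by
        rw [ENNReal.tsum_mul_right, ENNReal.tsum_mul_left]
        exact ENNReal.mul_lt_top (ENNReal.mul_lt_top ofReal_lt_top hsum'.tsum_ofReal_lt_top) hdecay
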